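/- arXiv:2206.01959 — 5 statements merged into one kernel-verified Lean document; each statement's English description precedes it below -/
import Mathlib

section
/- Dirichlet form comparison: let ε ∈ (0, K/2) and let ν be the product measure on Ω_N^d with marginal Binomial(K, ϱ_x/K) at site x, where ϱ_x ∈ [ε, K − ε] for every x. Then there exists δ₀ > 0, depending only on K, ε and the rates p_1, …, p_{2d}, such that for every ν-density f, D_N(f; ν) ≥ δ₀ Σ_{i=1}^{2d} Σ_{x ∈ 𝕋_N^d} Σ_η η_x (K − η_{x+e_i}) (√(f(η^{x,x+e_i})) − √(f(η)))² ν(η). -/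
open Real Filter

noncomputable section

/-- The discrete torus `𝕋_N^d`, realized as `d`-tuples of residues mod `N`. -/
abbrev Site (N d : ℕ) := Fin d → Fin N

/-- Configurations of the generalized exclusion process: at most `K` particles per site. -/
abbrev GCfg (N d K : ℕ) := Site N d → Fin (K + 1)

/-- Cyclic successor on `Fin N`. -/
def finCycAdd {N : ℕ} (a : Fin N) : Fin N :=
  ⟨(a.val + 1) % N, Nat.mod_lt _ (Nat.lt_of_le_of_lt (Nat.zero_le _) a.isLt)⟩

/-- Cyclic predecessor on `Fin N`. -/
def finCycSub {N : ℕ} (a : Fin N) : Fin N :=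
  ⟨(a.val + (N - 1)) % N, Nat.mod_lt _ (Nat.lt_of_le_of_lt (Nat.zero_le _) a.isLt)⟩

/-- The neighbour `x + e_i` (if `b = true`) resp. `x − e_i` (if `b = false`) of a site. -/
def siteMove {N d : ℕ} (x : Site N d) (i : Fin d) (b : Bool) : Site N d :=
  Function.update x i (if b then finCycAdd (x i) else finCycSub (x i))

/-- The configuration `η^{x,y}` obtained from `η` when one particle jumps from `x` to `y`. -/
def cfgJump {N d K : ℕ} (η : GCfg N d K) (x y : Site N d) : GCfg N d K := fun z =>
  if z = x then ⟨(η x).val - 1, lt_of_le_of_lt (Nat.sub_le _ _) (η x).isLt⟩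
  else if z = y then ⟨min ((η y).val + 1) K, Nat.lt_succ_of_le (min_le_right _ _)⟩
  else η z

/-- The jump rate `c_{x,i}(η) = p_i η_x (K − η_{x+e_i})`, with directions indexed by
`(i,b) ∈ Fin d × Bool`: `(i,true)` is `e_i` and `(i,false)` is `−e_i = e_{i+d}`. -/
def jumpRate {N d K : ℕ} (p : Fin d → Bool → ℝ) (η : GCfg N d K)
    (x : Site N d) (i : Fin d) (b : Bool) : ℝ :=
  p i b * ((η x).val : ℝ) * ((K : ℝ) - ((η (siteMove x i b)).val : ℝ))

/-- The generator `L_N` of the asymmetric generalized exclusion process. -/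
def genL {N d K : ℕ} (p : Fin d → Bool → ℝ) (f : GCfg N d K → ℝ) (η : GCfg N d K) : ℝ :=
  ∑ i : Fin d, ∑ b : Bool, ∑ x : Site N d,
    jumpRate p η x i b * (f (cfgJump η x (siteMove x i b)) - f η)

/-- The `Binomial (K, ϱ/K)` weight of the occupation number `k`. -/
def binomW (K : ℕ) (ϱ : ℝ) (k : ℕ) : ℝ :=
  (K.choose k : ℝ) * (ϱ / K) ^ k * (1 - ϱ / K) ^ (K - k)

/-- The product measure on configurations with `Binomial (K, ϱ_x/K)` marginals. -/
def prodBinom {N d K : ℕ} (ϱ : Site N d → ℝ) (η : GCfg N d K) : ℝ :=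
  ∏ x : Site N d, binomW K (ϱ x) (η x).val

/-- The relative entropy `H(μ|ν) = Σ_η f(η) log f(η) ν(η)` with `f = μ/ν`. -/
def relEnt {Ω : Type*} [Fintype Ω] (μ ν : Ω → ℝ) : ℝ :=
  ∑ η : Ω, (μ η / ν η) * Real.log (μ η / ν η) * ν η

/-- The Dirichlet form `D_N(f;ν)`. -/
def dirichletForm {N d K : ℕ} (p : Fin d → Bool → ℝ) (f ν : GCfg N d K → ℝ) : ℝ :=
  ∑ i : Fin d, ∑ b : Bool, ∑ x : Site N d, ∑ η : GCfg N d K,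
    jumpRate p η x i b *
      (Real.sqrt (f (cfgJump η x (siteMove x i b))) - Real.sqrt (f η)) ^ 2 * ν η

/-- The macroscopic coordinates `x/N ∈ 𝕋^d` of a site. -/
def siteCoord {N d : ℕ} (x : Site N d) : Fin d → ℝ := fun j => (x j : ℝ) / N

/-- The slowly varying density profile
`ϱ_N(t,u) = ϱ* + N^{−α} ρ(N^{κ−α} t, u − N^κ λ t m)`, with `λ = K − 2ϱ*`. -/
def profileGE (d K : ℕ) (ϱs α κ : ℝ) (m : Fin d → ℝ) (ρ : ℝ → (Fin d → ℝ) → ℝ)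
    (N : ℕ) (t : ℝ) (u : Fin d → ℝ) : ℝ :=
  ϱs + (N : ℝ) ^ (-α) * ρ ((N : ℝ) ^ (κ - α) * t)
    (fun j => u j - (N : ℝ) ^ κ * ((K : ℝ) - 2 * ϱs) * t * m j)

end

/-- The contribution of jumps from `x` to `y` to the Dirichlet form with unit rates. -/
noncomputable def bondForm {N d K : ℕ} (f ν : GCfg N d K → ℝ) (x y : Site N d) : ℝ :=
  ∑ η : GCfg N d K, ((η x).val : ℝ) * ((K : ℝ) - ((η y).val : ℝ)) *
    (Real.sqrt (f (cfgJump η x y)) - Real.sqrt (f η)) ^ 2 * ν η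

theorem finCycSub_finCycAdd {N : ℕ} (a : Fin N) : finCycSub (finCycAdd a) = a := by
  have ha := a.isLt
  ext
  simp only [finCycSub, finCycAdd, Nat.mod_add_mod]
  rw [show a.val + 1 + (N - 1) = a.val + N by omega, Nat.add_mod_right, Nat.mod_eq_of_lt ha]

theorem finCycAdd_finCycSub {N : ℕ} (a : Fin N) : finCycAdd (finCycSub a) = a := by
  have ha := a.isLt
  ext
  simp only [finCycSub, finCycAdd, Nat.mod_add_mod]
  rw [show a.val + (N - 1) + 1 = a.val + N by omega, Nat.add_mod_right, Nat.mod_eq_of_lt ha]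

theorem siteMove_siteMove_not {N d : ℕ} (x : Site N d) (i : Fin d) (b : Bool) :
    siteMove (siteMove x i b) i (!b) = x := by
  cases b <;> simp [siteMove, finCycSub_finCycAdd, finCycAdd_finCycSub]

/-- Moving by one step in a fixed direction, as a permutation of the torus. -/
def siteMoveEquiv {N d : ℕ} (i : Fin d) (b : Bool) : Site N d ≃ Site N d where
  toFun x := siteMove x i b
  invFun x := siteMove x i (!b)
  left_inv x := siteMove_siteMove_not x i b
  right_inv x := by simpa using siteMove_siteMove_not x i (!b)

theorem val_cfgJump_source {N d K : ℕ} (η : GCfg N d K) (x y : Site N d) :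
    (cfgJump η x y x).val = (η x).val - 1 := by
  simp [cfgJump]

theorem val_cfgJump_target {N d K : ℕ} (η : GCfg N d K) {x y : Site N d} (hxy : x ≠ y)
    (hy : (η y).val < K) : (cfgJump η x y y).val = (η y).val + 1 := by
  simp only [cfgJump, hxy.symm, if_true, if_false]
  omega

theorem cfgJump_of_ne {N d K : ℕ} (η : GCfg N d K) {x y z : Site N d} (hx : z ≠ x) (hy : z ≠ y) :
    cfgJump η x y z = η z := by
  simp [cfgJump, hx, hy]

theorem cfgJump_cfgJump {N d K : ℕ} (η : GCfg N d K) {x y : Site N d} (hxy : x ≠ y)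
    (hx : 0 < (η x).val) (hy : (η y).val < K) : cfgJump (cfgJump η x y) y x = η := by
  have hxK := (η x).isLt
  funext z
  by_cases hzx : z = x
  · subst hzx
    ext
    rw [val_cfgJump_target _ hxy.symm (by rw [val_cfgJump_source]; omega), val_cfgJump_source]
    omega
  · by_cases hzy : z = y
    · subst hzy
      ext
      rw [val_cfgJump_source, val_cfgJump_target _ hxy hy]
      omega
    · rw [cfgJump_of_ne _ hzy hzx, cfgJump_of_ne _ hzx hzy]

theorem binomW_nonneg {K : ℕ} {ϱ : ℝ} (h0 : 0 ≤ ϱ) (h1 : ϱ ≤ K) (k : ℕ) : 0 ≤ binomW K ϱ k := by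
  have : ϱ / K ≤ 1 := div_le_one_of_le₀ h1 (Nat.cast_nonneg K)
  have : 0 ≤ 1 - ϱ / K := by linarith
  unfold binomW
  positivity

theorem prodBinom_nonneg {N d K : ℕ} {ϱ : Site N d → ℝ} (h0 : ∀ x, 0 ≤ ϱ x) (h1 : ∀ x, ϱ x ≤ K)
    (η : GCfg N d K) : 0 ≤ prodBinom ϱ η :=
  Finset.prod_nonneg fun x _ => binomW_nonneg (h0 x) (h1 x) _

theorem binomW_succ_mul {K k : ℕ} (ϱ : ℝ) (hk : k < K) :
    (K - ϱ) * ((k + 1) * binomW K ϱ (k + 1)) = ϱ * ((K - k) * binomW K ϱ k) := by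
  have hK : (K : ℝ) ≠ 0 := by
    have : 0 < K := by omega
    positivity
  have hchoose : (K.choose (k + 1) : ℝ) * (k + 1) = K.choose k * (K - k) := by
    have h := Nat.choose_succ_right_eq K k
    rw [← Nat.cast_sub hk.le]
    exact_mod_cast h
  obtain ⟨m, rfl⟩ : ∃ m, K = k + 1 + m := ⟨K - (k + 1), by omega⟩
  unfold binomW
  rw [show k + 1 + m - (k + 1) = m by omega, show k + 1 + m - k = m + 1 by omega]
  generalize ((k + 1 + m : ℕ) : ℝ) = L at *
  have hL : L - ϱ = L * (1 - ϱ / L) := by field_simp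
  have hϱ : ϱ = L * (ϱ / L) := by field_simp
  rw [hL]
  nth_rewrite 4 [hϱ]
  generalize ϱ / L = t
  linear_combination (L * (1 - t) ^ (m + 1) * t ^ (k + 1)) * hchoose

theorem succ_mul_binomW_le {K k : ℕ} {ϱ ε : ℝ} (hε : 0 < ε) (hϱ : ϱ ∈ Set.Icc ε (K - ε))
    (hk : k < K) :
    (k + 1) * binomW K ϱ (k + 1) ≤ (K - ε) / ε * ((K - k) * binomW K ϱ k) := by
  have h := binomW_succ_mul ϱ hk
  have hkK : (k : ℝ) ≤ K := by exact_mod_cast hk.le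
  have h1 : 0 ≤ (k + 1) * binomW K ϱ (k + 1) :=
    mul_nonneg (by positivity) (binomW_nonneg (by linarith [hϱ.1]) (by linarith [hϱ.2]) _)
  have h2 : 0 ≤ (K - k) * binomW K ϱ k :=
    mul_nonneg (by linarith) (binomW_nonneg (by linarith [hϱ.1]) (by linarith [hϱ.2]) _)
  rw [div_mul_eq_mul_div, le_div_iff₀ hε]
  nlinarith [hϱ.1, hϱ.2]

theorem sub_mul_binomW_le {K k : ℕ} {ϱ ε : ℝ} (hε : 0 < ε) (hϱ : ϱ ∈ Set.Icc ε (K - ε))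
    (hk : k < K) :
    (K - k) * binomW K ϱ k ≤ (K - ε) / ε * ((k + 1) * binomW K ϱ (k + 1)) := by
  have h := binomW_succ_mul ϱ hk
  have hkK : (k : ℝ) ≤ K := by exact_mod_cast hk.le
  have h1 : 0 ≤ (k + 1) * binomW K ϱ (k + 1) :=
    mul_nonneg (by positivity) (binomW_nonneg (by linarith [hϱ.1]) (by linarith [hϱ.2]) _)
  have h2 : 0 ≤ (K - k) * binomW K ϱ k :=
    mul_nonneg (by linarith) (binomW_nonneg (by linarith [hϱ.1]) (by linarith [hϱ.2]) _)
  rw [div_mul_eq_mul_div, le_div_iff₀ hε]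
  nlinarith [hϱ.1, hϱ.2]

/-- Approximate detailed balance: reversing an admissible jump costs at most a factor
`((K - ε) / ε) ^ 2`. -/
theorem rate_mul_prodBinom_cfgJump_le {N d K : ℕ} {ε : ℝ} (hε : 0 < ε) {ϱ : Site N d → ℝ}
    (hϱ : ∀ x, ϱ x ∈ Set.Icc ε ((K : ℝ) - ε)) (η : GCfg N d K) {x y : Site N d} (hxy : x ≠ y)
    (hx : 0 < (η x).val) (hy : (η y).val < K) :
    ((cfgJump η x y y).val : ℝ) * (K - ((cfgJump η x y x).val : ℝ)) * prodBinom ϱ (cfgJump η x y) ≤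
      ((K - ε) / ε) ^ 2 * ((η x).val * (K - ((η y).val : ℝ)) * prodBinom ϱ η) := by
  classical
  have hε' : 0 ≤ (K - ε) / ε := div_nonneg (by linarith [(hϱ x).1, (hϱ x).2]) hε.le
  have h0 z : 0 ≤ ϱ z := hε.le.trans (hϱ z).1
  have h1 z : ϱ z ≤ K := by linarith [(hϱ z).2]
  have hsplit (ζ : GCfg N d K) : prodBinom ϱ ζ = binomW K (ϱ x) (ζ x).val *
      (binomW K (ϱ y) (ζ y).val *
        ∏ z ∈ (Finset.univ.erase x).erase y, binomW K (ϱ z) (ζ z).val) := by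
    rw [Finset.mul_prod_erase _ (fun z => binomW K (ϱ z) (ζ z).val) (by simp [hxy.symm]),
      Finset.mul_prod_erase _ (fun z => binomW K (ϱ z) (ζ z).val) (Finset.mem_univ x)]
    rfl
  have hrest : ∏ z ∈ (Finset.univ.erase x).erase y, binomW K (ϱ z) (cfgJump η x y z).val =
      ∏ z ∈ (Finset.univ.erase x).erase y, binomW K (ϱ z) (η z).val := by
    refine Finset.prod_congr rfl fun z hz => ?_
    simp only [Finset.mem_erase] at hz
    rw [cfgJump_of_ne _ hz.2.1 hz.1]
  have hR : 0 ≤ ∏ z ∈ (Finset.univ.erase x).erase y, binomW K (ϱ z) (η z).val :=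
    Finset.prod_nonneg fun z _ => binomW_nonneg (h0 z) (h1 z) _
  rw [hsplit, hsplit η, hrest, val_cfgJump_source, val_cfgJump_target _ hxy hy]
  generalize ∏ z ∈ (Finset.univ.erase x).erase y, binomW K (ϱ z) (η z).val = R at hR
  have hxK := (η x).isLt
  generalize (η y).val = j at hy
  obtain ⟨k, hk⟩ : ∃ k, (η x).val = k + 1 := ⟨(η x).val - 1, by omega⟩
  rw [hk] at hxK ⊢
  have hkK : k < K := by omega
  have hjR : (j : ℝ) ≤ K := by exact_mod_cast hy.le
  have hkR : (k : ℝ) ≤ K := by exact_mod_cast hkK.le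
  have hmul := mul_le_mul (sub_mul_binomW_le hε (hϱ x) hkK) (succ_mul_binomW_le hε (hϱ y) hy)
    (mul_nonneg (by positivity) (binomW_nonneg (h0 y) (h1 y) _))
    (mul_nonneg hε' (mul_nonneg (by positivity) (binomW_nonneg (h0 x) (h1 x) _)))
  have := mul_le_mul_of_nonneg_right hmul hR
  simp only [Nat.add_sub_cancel, Nat.cast_add, Nat.cast_one]
  linear_combination this

theorem bondForm_nonneg {N d K : ℕ} (f : GCfg N d K → ℝ) {ν : GCfg N d K → ℝ} (hν : ∀ η, 0 ≤ ν η)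
    (x y : Site N d) : 0 ≤ bondForm f ν x y := by
  refine Finset.sum_nonneg fun η _ => ?_
  have : ((η y).val : ℝ) ≤ K := by exact_mod_cast Nat.le_of_lt_succ (η y).isLt
  have : 0 ≤ (K : ℝ) - (η y).val := by linarith
  have := hν η
  positivity

/-- Only configurations in which the jump is possible contribute to `bondForm`. -/
theorem bondForm_eq_sum_filter {N d K : ℕ} (f ν : GCfg N d K → ℝ) (x y : Site N d) :
    bondForm f ν x y = ∑ η : GCfg N d K with 0 < (η x).val ∧ (η y).val < K,
      ((η x).val : ℝ) * ((K : ℝ) - ((η y).val : ℝ)) *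
        (Real.sqrt (f (cfgJump η x y)) - Real.sqrt (f η)) ^ 2 * ν η := by
  refine (Finset.sum_filter_of_ne fun η _ h => ?_).symm
  by_contra hcon
  apply h
  have := (η y).isLt
  obtain h0 | hK : (η x).val = 0 ∨ (η y).val = K := by omega
  · simp [h0]
  · simp [hK]

theorem bondForm_le_swap {N d K : ℕ} {ε : ℝ} (hε : 0 < ε) (hεK : ε < (K : ℝ) / 2)
    {ϱ : Site N d → ℝ} (hϱ : ∀ x, ϱ x ∈ Set.Icc ε ((K : ℝ) - ε)) (f : GCfg N d K → ℝ)
    (x y : Site N d) :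
    bondForm f (prodBinom ϱ) x y ≤ ((K - ε) / ε) ^ 2 * bondForm f (prodBinom ϱ) y x := by
  have h0 z : 0 ≤ ϱ z := hε.le.trans (hϱ z).1
  have h1 z : ϱ z ≤ K := by linarith [(hϱ z).2]
  obtain rfl | hxy := eq_or_ne x y
  · have hC : 1 ≤ (K - ε) / ε := (one_le_div hε).2 (by linarith)
    exact le_mul_of_one_le_left (bondForm_nonneg f (prodBinom_nonneg h0 h1) x x) (one_le_pow₀ hC)
  have hswap : bondForm f (prodBinom ϱ) x y =
      ∑ η : GCfg N d K with 0 < (η y).val ∧ (η x).val < K,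
        ((cfgJump η y x x).val : ℝ) * ((K : ℝ) - ((cfgJump η y x y).val : ℝ)) *
          (Real.sqrt (f η) - Real.sqrt (f (cfgJump η y x))) ^ 2 * prodBinom ϱ (cfgJump η y x) := by
    rw [bondForm_eq_sum_filter]
    refine Finset.sum_nbij' (fun η => cfgJump η x y) (fun η => cfgJump η y x) ?_ ?_ ?_ ?_ ?_ <;>
      simp only [Finset.mem_filter, Finset.mem_univ, true_and] <;> rintro η ⟨hη, hη'⟩
    · have := (η x).isLt
      rw [val_cfgJump_source, val_cfgJump_target _ hxy hη']
      omega
    · have := (η y).isLt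
      rw [val_cfgJump_source, val_cfgJump_target _ hxy.symm hη']
      omega
    · exact cfgJump_cfgJump η hxy hη hη'
    · exact cfgJump_cfgJump η hxy.symm hη hη'
    · rw [cfgJump_cfgJump η hxy hη hη']
  rw [hswap, bondForm_eq_sum_filter, Finset.mul_sum]
  refine Finset.sum_le_sum fun η hη => ?_
  simp only [Finset.mem_filter, Finset.mem_univ, true_and] at hη
  have := mul_le_mul_of_nonneg_right
    (rate_mul_prodBinom_cfgJump_le hε hϱ η hxy.symm hη.1 hη.2)
    (sq_nonneg (Real.sqrt (f (cfgJump η y x)) - Real.sqrt (f η)))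
  linear_combination this

theorem sum_bondForm_siteMove_le {N d K : ℕ} {ε : ℝ} (hε : 0 < ε) (hεK : ε < (K : ℝ) / 2)
    {ϱ : Site N d → ℝ} (hϱ : ∀ x, ϱ x ∈ Set.Icc ε ((K : ℝ) - ε)) (f : GCfg N d K → ℝ)
    (i : Fin d) (b : Bool) :
    ∑ x, bondForm f (prodBinom ϱ) x (siteMove x i b) ≤
      ((K - ε) / ε) ^ 2 * ∑ x, bondForm f (prodBinom ϱ) x (siteMove x i (!b)) := by
  rw [← Equiv.sum_comp (siteMoveEquiv i b)
    fun x => bondForm f (prodBinom ϱ) x (siteMove x i (!b)), Finset.mul_sum]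
  refine Finset.sum_le_sum fun x _ => ?_
  simpa [siteMoveEquiv, siteMove_siteMove_not] using
    bondForm_le_swap hε hεK hϱ f x (siteMove x i b)

theorem dirichletForm_eq_sum_bondForm {N d K : ℕ} (p : Fin d → Bool → ℝ) (f ν : GCfg N d K → ℝ) :
    dirichletForm p f ν = ∑ i, ∑ b, p i b * ∑ x, bondForm f ν x (siteMove x i b) := by
  simp only [dirichletForm, bondForm, jumpRate, Finset.mul_sum, mul_assoc]

/-- Dirichlet form comparison: if the density profile `ϱ` takes values in
`[ε, K − ε]`, the Dirichlet form of the asymmetric process dominates, up to a constant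
`δ₀ = δ₀(K, ε, p) > 0`, the fully symmetric-rate Dirichlet form. -/
theorem statement5 (d K : ℕ) (hd : 1 ≤ d) (hK : 1 ≤ K)
    (p : Fin d → Bool → ℝ) (hp : ∀ i b, 0 ≤ p i b)
    (hpd : ∀ i, 0 < p i true + p i false)
    (ε : ℝ) (hε : 0 < ε) (hεK : ε < (K : ℝ) / 2) :
    ∃ δ₀ : ℝ, 0 < δ₀ ∧
      ∀ (N : ℕ) (ϱ : Site N d → ℝ), (∀ x, ϱ x ∈ Set.Icc ε ((K : ℝ) - ε)) →
        ∀ f : GCfg N d K → ℝ, (∀ η, 0 ≤ f η) →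
          (∑ η : GCfg N d K, f η * prodBinom ϱ η = 1) →
          dirichletForm p f (prodBinom ϱ) ≥
            δ₀ * ∑ i : Fin d, ∑ b : Bool, ∑ x : Site N d, ∑ η : GCfg N d K,
              ((η x).val : ℝ) * ((K : ℝ) - ((η (siteMove x i b)).val : ℝ)) *
                (Real.sqrt (f (cfgJump η x (siteMove x i b))) - Real.sqrt (f η)) ^ 2 *
                prodBinom ϱ η := by
  have : Nonempty (Fin d) := ⟨⟨0, hd⟩⟩
  obtain ⟨j, hj⟩ := Finite.exists_min fun i => p i true + p i false
  set C : ℝ := ((K - ε) / ε) ^ 2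
  have hC : 0 < 1 + C := by positivity
  refine ⟨(p j true + p j false) / (1 + C), div_pos (hpd j) hC, fun N ϱ hϱ f _ _ => ?_⟩
  have hν : ∀ η : GCfg N d K, 0 ≤ prodBinom ϱ η :=
    prodBinom_nonneg (fun x => hε.le.trans (hϱ x).1) fun x => by linarith [(hϱ x).2]
  change _ * (∑ i, ∑ b, ∑ x, bondForm f (prodBinom ϱ) x (siteMove x i b)) ≤ _
  rw [dirichletForm_eq_sum_bondForm, Finset.mul_sum]
  refine Finset.sum_le_sum fun i _ => ?_
  rw [Fintype.sum_bool, Fintype.sum_bool]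
  have ht := sum_bondForm_siteMove_le hε hεK hϱ f i true
  have hf := sum_bondForm_siteMove_le hε hεK hϱ f i false
  have h0t : 0 ≤ ∑ x, bondForm f (prodBinom ϱ) x (siteMove x i true) :=
    Finset.sum_nonneg fun x _ => bondForm_nonneg f hν x _
  have h0f : 0 ≤ ∑ x, bondForm f (prodBinom ϱ) x (siteMove x i false) :=
    Finset.sum_nonneg fun x _ => bondForm_nonneg f hν x _
  simp only [Bool.not_true, Bool.not_false] at ht hf
  generalize ∑ x, bondForm f (prodBinom ϱ) x (siteMove x i true) = A at *
  generalize ∑ x, bondForm f (prodBinom ϱ) x (siteMove x i false) = B at *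
  rw [div_mul_eq_mul_div, div_le_iff₀ hC]
  have h1 := mul_le_mul_of_nonneg_right (hj i) (add_nonneg h0t h0f)
  have h2 := mul_le_mul_of_nonneg_left hf (hp i true)
  have h3 := mul_le_mul_of_nonneg_left ht (hp i false)
  linear_combination h1 + h2 + h3
end

section
/- Flow lemma: for each d ≥ 1 there exists a finite constant C₀ such that for every integer ℓ ≥ 1 there exists a flow φ_ℓ connecting δ₀ to 𝔮_ℓ whose support is contained in Λ_{2ℓ−1}^d, satisfying Σ_{i=1}^d Σ_{z ∈ ℤ^d} φ_ℓ(z, e_i)² ≤ C₀ g_d(ℓ) and Σ_{i=1}^d Σ_{z ∈ ℤ^d} |φ_ℓ(z, e_i)| ≤ C₀ ℓ. -/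
open scoped BigOperators

noncomputable section

/-- The uniform probability measure on the box `Λ_ℓ^d = {0,…,ℓ−1}^d ⊆ ℤ^d`. -/
def unifBox (d ℓ : ℕ) (z : Fin d → ℤ) : ℝ :=
  if ∀ i, 0 ≤ z i ∧ z i < (ℓ : ℤ) then ((ℓ : ℝ) ^ d)⁻¹ else 0

/-- The self-convolution `𝔮_ℓ = 𝔭_ℓ ∗ 𝔭_ℓ` of the uniform measure on `Λ_ℓ^d`. -/
def convBox (d ℓ : ℕ) (z : Fin d → ℤ) : ℝ :=
  ∑ y ∈ Finset.Icc (0 : Fin d → ℤ) (fun _ => (ℓ : ℤ) - 1),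
    unifBox d ℓ y * unifBox d ℓ (z - y)

/-- `g_d(ℓ)`: `ℓ` in dimension 1, `log ℓ` in dimension 2, `1` in dimension `≥ 3`. -/
def gdim (d ℓ : ℕ) : ℝ :=
  if d = 1 then (ℓ : ℝ) else if d = 2 then Real.log ℓ else 1

/-- The uniform density on `{0, …, k-1} ⊆ ℤ`. -/
def unifInterval (k : ℕ) (x : ℤ) : ℝ :=
  if 0 ≤ x ∧ x < (k : ℤ) then (k : ℝ)⁻¹ else 0

/-- Convolution of two functions on `ℤ` supported on the nonnegative integers. -/
def causalConv (a b : ℤ → ℝ) (x : ℤ) : ℝ :=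
  ∑ y ∈ Finset.Icc 0 x, a y * b (x - y)

/-- The triangular density: the self-convolution of `unifInterval k`. -/
def triangle (k : ℕ) : ℤ → ℝ := causalConv (unifInterval k) (unifInterval k)

/-- The one-dimensional flow from `unifInterval k` to `unifInterval (k + 1)`. -/
def unifFlow (k : ℕ) (x : ℤ) : ℝ :=
  if 0 ≤ x ∧ x < (k : ℤ) then ((x : ℝ) + 1) / (k * (k + 1)) else 0

/-- The one-dimensional flow from `triangle k` to `triangle (k + 1)`. -/
def triangleFlow (k : ℕ) (x : ℤ) : ℝ :=
  causalConv (unifInterval k) (unifFlow k) x + causalConv (unifInterval (k + 1)) (unifFlow k) x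

/-- The flow from the product of the `triangle k` to the product of the `triangle (k + 1)`,
replacing one coordinate after the other. -/
def stepFlow (d k : ℕ) (z : Fin d → ℤ) (i : Fin d) : ℝ :=
  ∏ j, if j < i then triangle k (z j) else
    if j = i then triangleFlow k (z j) else triangle (k + 1) (z j)

lemma unifInterval_nonneg (k : ℕ) (x : ℤ) : 0 ≤ unifInterval k x := by
  unfold unifInterval; split_ifs <;> positivity

lemma unifInterval_le (k : ℕ) (x : ℤ) : unifInterval k x ≤ (k : ℝ)⁻¹ := by
  unfold unifInterval
  split_ifs
  · exact le_rfl
  · positivity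

lemma unifInterval_eq_zero {k : ℕ} {x : ℤ} (h : ¬ (0 ≤ x ∧ x < (k : ℤ))) :
    unifInterval k x = 0 := if_neg h

lemma unifFlow_eq_zero {k : ℕ} {x : ℤ} (h : ¬ (0 ≤ x ∧ x < (k : ℤ))) :
    unifFlow k x = 0 := if_neg h

lemma abs_unifFlow_le (k : ℕ) (x : ℤ) : |unifFlow k x| ≤ (k : ℝ)⁻¹ := by
  unfold unifFlow
  split_ifs with h
  · have h0 : (0 : ℝ) ≤ x := by exact_mod_cast h.1
    have h1 : (x : ℝ) + 1 ≤ k := by exact_mod_cast h.2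
    have hk : (0 : ℝ) < k := by linarith
    rw [abs_of_nonneg (by positivity), inv_eq_one_div, div_le_div_iff₀ (by positivity) hk]
    nlinarith
  · simp

lemma unifFlow_sub (k : ℕ) (hk : 1 ≤ k) (x : ℤ) :
    unifFlow k x - unifFlow k (x - 1) = unifInterval k x - unifInterval (k + 1) x := by
  have hk' : (0 : ℝ) < k := by exact_mod_cast hk
  unfold unifFlow unifInterval
  push_cast
  rcases lt_trichotomy x 0 with h | h | h
  · rw [if_neg (by omega), if_neg (by omega), if_neg (by omega), if_neg (by omega)]
  · subst h
    rw [if_pos (by omega), if_neg (by omega), if_pos (by omega), if_pos (by omega)]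
    push_cast
    field_simp
    ring
  · rcases lt_trichotomy x k with h' | h' | h'
    · rw [if_pos (by omega), if_pos (by omega), if_pos (by omega), if_pos (by omega)]
      field_simp
      ring
    · subst h'
      rw [if_neg (by omega), if_pos (by omega), if_neg (by omega), if_pos (by omega)]
      push_cast
      field_simp
      ring
    · rw [if_neg (by omega), if_neg (by omega), if_neg (by omega), if_neg (by omega)]

lemma sum_unifInterval_le_one (k : ℕ) (x : ℤ) :
    ∑ y ∈ Finset.Icc 0 x, unifInterval k y ≤ 1 := by
  unfold unifInterval
  rw [← Finset.sum_filter, Finset.sum_const, nsmul_eq_mul]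
  have hsub : (Finset.Icc 0 x).filter (fun y => 0 ≤ y ∧ y < (k : ℤ)) ⊆ Finset.Ico 0 (k : ℤ) := by
    intro y hy
    simp only [Finset.mem_filter] at hy
    exact Finset.mem_Ico.2 hy.2
  have hcard := Finset.card_le_card hsub
  simp only [Int.card_Ico, sub_zero, Int.toNat_natCast] at hcard
  calc _ ≤ (k : ℝ) * (k : ℝ)⁻¹ := by gcongr
    _ ≤ 1 := mul_inv_le_one

lemma abs_causalConv_unifInterval_le (k : ℕ) {b : ℤ → ℝ} {c : ℝ} (hc : 0 ≤ c)
    (hb : ∀ x, |b x| ≤ c) (x : ℤ) : |causalConv (unifInterval k) b x| ≤ c := by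
  calc |causalConv (unifInterval k) b x|
      ≤ ∑ y ∈ Finset.Icc 0 x, |unifInterval k y * b (x - y)| := Finset.abs_sum_le_sum_abs _ _
    _ ≤ ∑ y ∈ Finset.Icc 0 x, unifInterval k y * c := by
        refine Finset.sum_le_sum fun y _ => ?_
        rw [abs_mul, abs_of_nonneg (unifInterval_nonneg k y)]
        exact mul_le_mul_of_nonneg_left (hb _) (unifInterval_nonneg k y)
    _ = (∑ y ∈ Finset.Icc 0 x, unifInterval k y) * c := by rw [Finset.sum_mul]
    _ ≤ 1 * c := mul_le_mul_of_nonneg_right (sum_unifInterval_le_one k x) hc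
    _ = c := one_mul c

lemma causalConv_unifInterval_support {k m : ℕ} {b : ℤ → ℝ}
    (hb : ∀ x, ¬ (0 ≤ x ∧ x < (m : ℤ)) → b x = 0) {x : ℤ}
    (h : causalConv (unifInterval k) b x ≠ 0) : 0 ≤ x ∧ x + 2 ≤ (k : ℤ) + m := by
  obtain ⟨y, hy, hne⟩ := Finset.exists_ne_zero_of_sum_ne_zero h
  have h1 : 0 ≤ y ∧ y < (k : ℤ) := by
    by_contra hcon
    exact hne (by rw [unifInterval_eq_zero hcon, zero_mul])
  have h2 : 0 ≤ x - y ∧ x - y < (m : ℤ) := by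
    by_contra hcon
    exact hne (by rw [hb _ hcon, mul_zero])
  omega

lemma causalConv_comm (a b : ℤ → ℝ) (x : ℤ) : causalConv a b x = causalConv b a x := by
  unfold causalConv
  refine Finset.sum_nbij' (fun y => x - y) (fun y => x - y) ?_ ?_ ?_ ?_ ?_
  · intro y hy
    simp only [Finset.mem_Icc] at hy ⊢
    omega
  · intro y hy
    simp only [Finset.mem_Icc] at hy ⊢
    omega
  · intro y _; ring
  · intro y _; ring
  · intro y _
    rw [sub_sub_cancel, mul_comm]

lemma causalConv_sub_shift (a b : ℤ → ℝ) (hb : b (-1) = 0) (x : ℤ) :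
    causalConv a b x - causalConv a b (x - 1) = causalConv a (fun y => b y - b (y - 1)) x := by
  have hshift : causalConv a b (x - 1) = ∑ y ∈ Finset.Icc 0 x, a y * b (x - y - 1) := by
    unfold causalConv
    have hsub : Finset.Icc 0 (x - 1) ⊆ Finset.Icc 0 x := Finset.Icc_subset_Icc_right (by omega)
    rw [← Finset.sum_subset hsub]
    · refine Finset.sum_congr rfl fun y _ => ?_
      rw [sub_right_comm]
    · intro y hy hy'
      simp only [Finset.mem_Icc] at hy hy'
      have : x - y - 1 = -1 := by omega
      rw [this, hb, mul_zero]
  rw [hshift]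
  unfold causalConv
  rw [← Finset.sum_sub_distrib]
  exact Finset.sum_congr rfl fun y _ => (mul_sub _ _ _).symm

lemma causalConv_sub_right (a b c : ℤ → ℝ) (x : ℤ) :
    causalConv a (fun y => b y - c y) x = causalConv a b x - causalConv a c x := by
  unfold causalConv
  rw [← Finset.sum_sub_distrib]
  exact Finset.sum_congr rfl fun y _ => mul_sub _ _ _

lemma triangleFlow_sub (k : ℕ) (hk : 1 ≤ k) (x : ℤ) :
    triangleFlow k x - triangleFlow k (x - 1) = triangle k x - triangle (k + 1) x := by
  have hstep (m : ℕ) : causalConv (unifInterval m) (unifFlow k) x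
      - causalConv (unifInterval m) (unifFlow k) (x - 1)
      = causalConv (unifInterval m) (unifInterval k) x
        - causalConv (unifInterval m) (unifInterval (k + 1)) x := by
    rw [causalConv_sub_shift _ _ (unifFlow_eq_zero (by omega)), ← causalConv_sub_right]
    simp_rw [unifFlow_sub k hk]
  have hcomm := causalConv_comm (unifInterval k) (unifInterval (k + 1)) x
  unfold triangleFlow triangle
  linarith [hstep k, hstep (k + 1)]

lemma abs_triangle_le (k : ℕ) (x : ℤ) : |triangle k x| ≤ (k : ℝ)⁻¹ :=
  abs_causalConv_unifInterval_le k (by positivity)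
    (fun y => by rw [abs_of_nonneg (unifInterval_nonneg k y)]; exact unifInterval_le k y) x

lemma abs_triangleFlow_le (k : ℕ) (x : ℤ) : |triangleFlow k x| ≤ 2 * (k : ℝ)⁻¹ := by
  have h (m : ℕ) : |causalConv (unifInterval m) (unifFlow k) x| ≤ (k : ℝ)⁻¹ :=
    abs_causalConv_unifInterval_le m (by positivity) (abs_unifFlow_le k) x
  unfold triangleFlow
  linarith [abs_add_le (causalConv (unifInterval k) (unifFlow k) x)
    (causalConv (unifInterval (k + 1)) (unifFlow k) x), h k, h (k + 1)]

lemma triangle_support {k : ℕ} {x : ℤ} (h : triangle k x ≠ 0) :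
    0 ≤ x ∧ x + 2 ≤ 2 * (k : ℤ) := by
  have := causalConv_unifInterval_support (fun _ => unifInterval_eq_zero) h
  omega

lemma triangleFlow_support {k : ℕ} {x : ℤ} (h : triangleFlow k x ≠ 0) :
    0 ≤ x ∧ x + 1 ≤ 2 * (k : ℤ) := by
  by_cases h1 : causalConv (unifInterval k) (unifFlow k) x = 0
  · have h2 : causalConv (unifInterval (k + 1)) (unifFlow k) x ≠ 0 := by
      intro h2
      exact h (by rw [triangleFlow, h1, h2, add_zero])
    have := causalConv_unifInterval_support (fun _ => unifFlow_eq_zero) h2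
    push_cast at this
    omega
  · have := causalConv_unifInterval_support (fun _ => unifFlow_eq_zero) h1
    omega

lemma triangle_one (x : ℤ) : triangle 1 x = if x = 0 then 1 else 0 := by
  split_ifs with h
  · subst h
    simp [triangle, causalConv, unifInterval]
  · by_contra hne
    have := triangle_support hne
    push_cast at this
    omega

lemma unifBox_eq_prod (d ℓ : ℕ) (z : Fin d → ℤ) : unifBox d ℓ z = ∏ i, unifInterval ℓ (z i) := by
  simp [unifBox, unifInterval, Finset.prod_ite_zero]

lemma sum_Icc_eq_triangle (ℓ : ℕ) (x : ℤ) :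
    ∑ y ∈ Finset.Icc (0 : ℤ) ((ℓ : ℤ) - 1), unifInterval ℓ y * unifInterval ℓ (x - y)
      = triangle ℓ x := by
  unfold triangle causalConv
  refine Finset.sum_congr_of_eq_on_inter ?_ ?_ fun _ _ _ => rfl
  · intro y h1 h2
    simp only [Finset.mem_Icc] at h1 h2
    rw [unifInterval_eq_zero (x := x - y) (by omega), mul_zero]
  · intro y h1 h2
    simp only [Finset.mem_Icc] at h1 h2
    rw [unifInterval_eq_zero (x := y) (by omega), zero_mul]

lemma convBox_eq_prod (d ℓ : ℕ) (z : Fin d → ℤ) : convBox d ℓ z = ∏ i, triangle ℓ (z i) := by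
  simp_rw [← sum_Icc_eq_triangle, convBox, unifBox_eq_prod, ← Finset.prod_mul_distrib]
  rw [Finset.prod_univ_sum]
  rfl

lemma prod_ite_lt_eq {d : ℕ} (i : Fin d) (a b : Fin d → ℝ) (c : Fin d → ℝ) :
    (∏ j, if j < i then a j else if j = i then c j else b j)
      = c i * (∏ j with j < i, a j) * ∏ j with i < j, b j := by
  rw [Finset.prod_ite]
  have hsplit : (Finset.univ.filter fun j => ¬ j < i)
      = insert i (Finset.univ.filter fun j => i < j) := by
    ext j
    simp only [Finset.mem_filter, Finset.mem_univ, true_and, Finset.mem_insert]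
    omega
  rw [hsplit, Finset.prod_insert (by simp)]
  have hb : (∏ j with i < j, if j = i then c j else b j) = ∏ j with i < j, b j := by
    refine Finset.prod_congr rfl fun j hj => if_neg ?_
    simp only [Finset.mem_filter] at hj
    omega
  rw [hb, if_pos rfl]
  ring

lemma sum_stepFlow_sub (d k : ℕ) (hk : 1 ≤ k) (z : Fin d → ℤ) :
    ∑ i, (stepFlow d k z i - stepFlow d k (z - Pi.single i 1) i)
      = (∏ i, triangle k (z i)) - ∏ i, triangle (k + 1) (z i) := by
  have hprod := Finset.prod_add_ordered (Finset.univ : Finset (Fin d))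
    (fun i => triangle (k + 1) (z i)) (fun i => triangle k (z i) - triangle (k + 1) (z i))
  simp only [add_sub_cancel] at hprod
  rw [hprod, add_sub_cancel_left]
  refine Finset.sum_congr rfl fun i _ => ?_
  rw [stepFlow, stepFlow, prod_ite_lt_eq, prod_ite_lt_eq]
  have hlt : ∏ j with j < i, triangle k ((z - Pi.single i 1 : Fin d → ℤ) j)
      = ∏ j with j < i, triangle k (z j) := by
    refine Finset.prod_congr rfl fun j hj => ?_
    simp only [Finset.mem_filter] at hj
    simp [Pi.single_eq_of_ne hj.2.ne]
  have hgt : ∏ j with i < j, triangle (k + 1) ((z - Pi.single i 1 : Fin d → ℤ) j)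
      = ∏ j with i < j, triangle (k + 1) (z j) := by
    refine Finset.prod_congr rfl fun j hj => ?_
    simp only [Finset.mem_filter] at hj
    simp [Pi.single_eq_of_ne hj.2.ne']
  rw [hlt, hgt, ← triangleFlow_sub k hk, Pi.sub_apply, Pi.single_eq_same]
  ring

lemma stepFlow_support {d k : ℕ} {z : Fin d → ℤ} {i : Fin d} (h : stepFlow d k z i ≠ 0) :
    (∀ j, 0 ≤ z j ∧ z j ≤ 2 * (k : ℤ)) ∧ z i + 1 ≤ 2 * (k : ℤ) := by
  have hfac := Finset.prod_ne_zero_iff.1 h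
  constructor
  · intro j
    have hj := hfac j (Finset.mem_univ j)
    split_ifs at hj
    · have := triangle_support hj
      omega
    · have := triangleFlow_support hj
      omega
    · have := triangle_support hj
      push_cast at this
      omega
  · have hi := hfac i (Finset.mem_univ i)
    rw [if_neg (lt_irrefl i), if_pos rfl] at hi
    exact (triangleFlow_support hi).2

lemma abs_stepFlow_le (d k : ℕ) (hk : 1 ≤ k) (z : Fin d → ℤ) (i : Fin d) :
    |stepFlow d k z i| ≤ (2 * (k : ℝ)⁻¹) ^ d := by
  have hk' : (0 : ℝ) < k := by exact_mod_cast hk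
  have hinv : (0 : ℝ) < (k : ℝ)⁻¹ := by positivity
  rw [stepFlow, Finset.abs_prod]
  calc _ ≤ ∏ _j : Fin d, 2 * (k : ℝ)⁻¹ := by
        refine Finset.prod_le_prod (fun _ _ => abs_nonneg _) fun j _ => ?_
        split_ifs
        · linarith [abs_triangle_le k (z j)]
        · exact abs_triangleFlow_le k (z j)
        · have h1 := abs_triangle_le (k + 1) (z j)
          have h2 : ((k + 1 : ℕ) : ℝ)⁻¹ ≤ (k : ℝ)⁻¹ := by
            gcongr
            omega
          linarith
    _ = _ := by simp

lemma sum_abs_stepFlow_le (d k : ℕ) (hk : 1 ≤ k) (i : Fin d) (s : Finset (Fin d → ℤ)) :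
    ∑ z ∈ s, |stepFlow d k z i| ≤ 6 ^ d := by
  have hk' : (1 : ℝ) ≤ k := by exact_mod_cast hk
  set t : Finset (Fin d → ℤ) := Finset.Icc 0 (fun _ => 2 * (k : ℤ)) with ht
  have hcard : t.card = (2 * k + 1) ^ d := by
    rw [ht, Pi.card_Icc]
    simp only [Pi.zero_apply, Int.card_Icc, Finset.prod_const, Finset.card_univ, Fintype.card_fin]
    rfl
  have hst : ∑ z ∈ s, |stepFlow d k z i| ≤ ∑ z ∈ t, |stepFlow d k z i| := by
    rw [← Finset.sum_filter_ne_zero s]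
    refine Finset.sum_le_sum_of_subset_of_nonneg (fun z hz => ?_) fun _ _ _ => abs_nonneg _
    have hsupp := (stepFlow_support (abs_ne_zero.1 (Finset.mem_filter.1 hz).2)).1
    exact Finset.mem_Icc.2 ⟨fun j => (hsupp j).1, fun j => (hsupp j).2⟩
  calc _ ≤ ∑ z ∈ t, |stepFlow d k z i| := hst
    _ ≤ ∑ _z ∈ t, (2 * (k : ℝ)⁻¹) ^ d := Finset.sum_le_sum fun z _ => abs_stepFlow_le d k hk z i
    _ = ((2 * k + 1) * (2 * (k : ℝ)⁻¹)) ^ d := by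
        rw [Finset.sum_const, hcard, nsmul_eq_mul]
        push_cast
        rw [← mul_pow]
    _ ≤ 6 ^ d := by
        refine pow_le_pow_left₀ (by positivity) ?_ d
        rw [← div_eq_mul_inv, ← mul_div_assoc, div_le_iff₀ (by positivity)]
        linarith

lemma sum_abs_sum_le {α : Type*} (s : Finset α) (ψ : ℕ → α → ℝ) (M : ℝ)
    (hM : ∀ n, ∑ z ∈ s, |ψ n z| ≤ M) (m : ℕ) :
    ∑ z ∈ s, |∑ n ∈ Finset.range m, ψ n z| ≤ m * M := by
  calc _ ≤ ∑ z ∈ s, ∑ n ∈ Finset.range m, |ψ n z| :=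
        Finset.sum_le_sum fun z _ => Finset.abs_sum_le_sum_abs _ _
    _ = ∑ n ∈ Finset.range m, ∑ z ∈ s, |ψ n z| := Finset.sum_comm
    _ ≤ ∑ _n ∈ Finset.range m, M := Finset.sum_le_sum fun n _ => hM n
    _ = m * M := by simp

lemma sum_sq_sum_le {α : Type*} (s : Finset α) (ψ : ℕ → α → ℝ) (M : ℝ) (c : ℕ → ℝ)
    (hc : ∀ n z, |ψ n z| ≤ c n) (hc0 : ∀ n, 0 ≤ c n) (hM : ∀ n, ∑ z ∈ s, |ψ n z| ≤ M) (m : ℕ) :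
    ∑ z ∈ s, (∑ n ∈ Finset.range m, ψ n z) ^ 2
      ≤ 2 * M * ∑ n ∈ Finset.range m, ((n : ℝ) + 1) * c n := by
  induction m with
  | zero => simp
  | succ m ih =>
    have hM0 : 0 ≤ M := (Finset.sum_nonneg fun z _ => abs_nonneg (ψ 0 z)).trans (hM 0)
    have hpt (z : α) : (∑ n ∈ Finset.range (m + 1), ψ n z) ^ 2
        ≤ (∑ n ∈ Finset.range m, ψ n z) ^ 2
          + c m * (2 * |∑ n ∈ Finset.range m, ψ n z| + |ψ m z|) := by
      rw [Finset.sum_range_succ]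
      set S := ∑ n ∈ Finset.range m, ψ n z
      have h1 : S * ψ m z ≤ |S| * c m := by
        calc S * ψ m z ≤ |S * ψ m z| := le_abs_self _
          _ = |S| * |ψ m z| := abs_mul _ _
          _ ≤ |S| * c m := mul_le_mul_of_nonneg_left (hc m z) (abs_nonneg _)
      have h2 : ψ m z ^ 2 ≤ c m * |ψ m z| := by
        rw [← sq_abs, sq]
        exact mul_le_mul_of_nonneg_right (hc m z) (abs_nonneg _)
      nlinarith
    calc _ ≤ ∑ z ∈ s, ((∑ n ∈ Finset.range m, ψ n z) ^ 2
          + c m * (2 * |∑ n ∈ Finset.range m, ψ n z| + |ψ m z|)) :=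
          Finset.sum_le_sum fun z _ => hpt z
      _ = ∑ z ∈ s, (∑ n ∈ Finset.range m, ψ n z) ^ 2
          + c m * (2 * ∑ z ∈ s, |∑ n ∈ Finset.range m, ψ n z| + ∑ z ∈ s, |ψ m z|) := by
          rw [Finset.sum_add_distrib, ← Finset.mul_sum, Finset.sum_add_distrib, ← Finset.mul_sum]
      _ ≤ 2 * M * ∑ n ∈ Finset.range m, ((n : ℝ) + 1) * c n + c m * (2 * (m * M) + M) := by
          have h3 := sum_abs_sum_le s ψ M hM m
          have h4 := hM m
          have h5 := hc0 m
          gcongr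
      _ ≤ _ := by
          rw [Finset.sum_range_succ]
          nlinarith [mul_nonneg (hc0 m) hM0]

lemma sum_inv_sq_le (m : ℕ) :
    ∑ n ∈ Finset.range (m + 1), (((n : ℝ) + 1) ^ 2)⁻¹ ≤ 2 - ((m : ℝ) + 1)⁻¹ := by
  induction m with
  | zero => norm_num
  | succ m ih =>
    rw [Finset.sum_range_succ]
    push_cast
    have h : (((m : ℝ) + 1 + 1) ^ 2)⁻¹ ≤ ((m : ℝ) + 1)⁻¹ - ((m : ℝ) + 1 + 1)⁻¹ := by
      have hpos : (0 : ℝ) < m + 1 := by positivity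
      rw [inv_sub_inv (by positivity) (by positivity), add_sub_cancel_left, inv_eq_one_div]
      exact one_div_le_one_div_of_le (by positivity) (by nlinarith)
    linarith

lemma sum_scales_le_gdim (d m : ℕ) (hd : 1 ≤ d) :
    ∑ n ∈ Finset.range m, ((n : ℝ) + 1) * (((n : ℝ) + 1)⁻¹) ^ d ≤ 3 * gdim d (m + 1) := by
  have hterm (n : ℕ) (e : ℕ) :
      ((n : ℝ) + 1) * (((n : ℝ) + 1)⁻¹) ^ (e + 1) = (((n : ℝ) + 1)⁻¹) ^ e := by
    have : (n : ℝ) + 1 ≠ 0 := by positivity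
    rw [pow_succ', mul_inv_cancel_left₀ this]
  obtain ⟨e, rfl⟩ := Nat.exists_eq_add_of_le' hd
  simp_rw [hterm]
  rcases e with _ | _ | e
  · simp [gdim]
    linarith [(Nat.cast_nonneg m : (0 : ℝ) ≤ m)]
  · simp only [gdim, zero_add, pow_one]
    norm_num
    rcases Nat.eq_zero_or_pos m with rfl | hm
    · simp
    have hharm := harmonic_le_one_add_log m
    have hcast : ((harmonic m : ℚ) : ℝ) = ∑ n ∈ Finset.range m, ((n : ℝ) + 1)⁻¹ := by
      simp [harmonic]
    rw [hcast] at hharm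
    have hm' : (1 : ℝ) ≤ m := by exact_mod_cast hm
    have h1 : Real.log m ≤ Real.log (m + 1) := Real.log_le_log (by linarith) (by linarith)
    have h2 : Real.log 2 ≤ Real.log (m + 1) := Real.log_le_log (by norm_num) (by linarith)
    linarith [Real.log_two_gt_d9]
  · have hg : gdim (e + 1 + 1 + 1) (m + 1) = 1 := by simp [gdim]
    rw [hg]
    calc _ ≤ ∑ n ∈ Finset.range m, (((n : ℝ) + 1) ^ 2)⁻¹ := by
          refine Finset.sum_le_sum fun n _ => ?_
          rw [← inv_pow]
          refine pow_le_pow_of_le_one (by positivity) ?_ (by omega)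
          exact inv_le_one_of_one_le₀ (by linarith [(Nat.cast_nonneg n : (0 : ℝ) ≤ n)])
      _ ≤ ∑ n ∈ Finset.range (m + 1), (((n : ℝ) + 1) ^ 2)⁻¹ := by
          rw [Finset.sum_range_succ]
          exact le_add_of_nonneg_right (by positivity)
      _ ≤ 2 - ((m : ℝ) + 1)⁻¹ := sum_inv_sq_le m
      _ ≤ 3 * 1 := by
          have : 0 ≤ ((m : ℝ) + 1)⁻¹ := by positivity
          linarith

/-- Flow lemma (Jara–Menezes): there is a constant `C₀ = C₀(d)` such that for every
`ℓ ≥ 1` there is a flow `φ_ℓ` connecting the Dirac mass at the origin `δ₀` to `𝔮_ℓ`,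
supported on edges inside `Λ_{2ℓ−1}^d`, with
`Σ_{i,z} φ_ℓ(z,e_i)² ≤ C₀ g_d(ℓ)` and `Σ_{i,z} |φ_ℓ(z,e_i)| ≤ C₀ ℓ`. -/
theorem statement9 (d : ℕ) (hd : 1 ≤ d) :
    ∃ C₀ : ℝ, ∀ ℓ : ℕ, 1 ≤ ℓ →
      ∃ φ : (Fin d → ℤ) → Fin d → ℝ,
        -- φ is a flow connecting δ₀ to 𝔮_ℓ
        (∀ z : Fin d → ℤ,
          (if z = 0 then (1 : ℝ) else 0) - convBox d ℓ z
            = ∑ i, (φ z i - φ (z - Pi.single i 1) i)) ∧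
        -- the support of the flow is contained in Λ_{2ℓ−1}^d
        (∀ (z : Fin d → ℤ) (i : Fin d), φ z i ≠ 0 →
          (∀ j, 0 ≤ z j ∧ z j ≤ 2 * (ℓ : ℤ) - 2) ∧
          (∀ j, 0 ≤ z j + (Pi.single i 1 : Fin d → ℤ) j ∧ z j + (Pi.single i 1 : Fin d → ℤ) j ≤ 2 * (ℓ : ℤ) - 2)) ∧
        (∑' z : Fin d → ℤ, ∑ i, (φ z i) ^ 2 ≤ C₀ * gdim d ℓ) ∧
        (∑' z : Fin d → ℤ, ∑ i, |φ z i| ≤ C₀ * (ℓ : ℝ)) := by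
  refine ⟨d * (2 * 6 ^ d * (2 ^ d * 3)), fun ℓ hℓ => ?_⟩
  obtain ⟨m, rfl⟩ := Nat.exists_eq_add_of_le' hℓ
  let φ : (Fin d → ℤ) → Fin d → ℝ := fun z i => ∑ n ∈ Finset.range m, stepFlow d (n + 1) z i
  have hsupp (z : Fin d → ℤ) (i : Fin d) (h : φ z i ≠ 0) :
      (∀ j, 0 ≤ z j ∧ z j ≤ 2 * (m : ℤ)) ∧ z i + 1 ≤ 2 * (m : ℤ) := by
    obtain ⟨n, hn, hne⟩ := Finset.exists_ne_zero_of_sum_ne_zero h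
    have hn' := Finset.mem_range.1 hn
    obtain ⟨h1, h2⟩ := stepFlow_support hne
    push_cast at h1 h2
    refine ⟨fun j => ?_, by omega⟩
    have := h1 j
    omega
  set B : Finset (Fin d → ℤ) := Finset.Icc 0 (fun _ => 2 * (m : ℤ))
  have hB (z : Fin d → ℤ) (hz : z ∉ B) (i : Fin d) : φ z i = 0 := by
    by_contra hne
    have h1 := (hsupp z i hne).1
    exact hz (Finset.mem_Icc.2 ⟨fun j => (h1 j).1, fun j => (h1 j).2⟩)
  have hM (i : Fin d) (n : ℕ) : ∑ z ∈ B, |stepFlow d (n + 1) z i| ≤ 6 ^ d :=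
    sum_abs_stepFlow_le d (n + 1) (by omega) i B
  refine ⟨φ, fun z => ?_, fun z i h => ?_, ?_, ?_⟩
  · have hδ : (if z = 0 then (1 : ℝ) else 0) = ∏ i, triangle 1 (z i) := by
      simp_rw [triangle_one, Finset.prod_ite_zero, funext_iff]
      simp
    have htel : ∑ n ∈ Finset.range m,
        ((∏ i, triangle (n + 1) (z i)) - ∏ i, triangle (n + 1 + 1) (z i))
        = (∏ i, triangle 1 (z i)) - ∏ i, triangle (m + 1) (z i) :=
      Finset.sum_range_sub' (fun n => ∏ i, triangle (n + 1) (z i)) m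
    rw [hδ, convBox_eq_prod, ← htel]
    simp only [φ, ← Finset.sum_sub_distrib]
    rw [Finset.sum_comm]
    exact Finset.sum_congr rfl fun n _ => (sum_stepFlow_sub d (n + 1) (by omega) z).symm
  · obtain ⟨h1, h2⟩ := hsupp z i h
    push_cast
    refine ⟨fun j => ?_, fun j => ?_⟩
    · have := h1 j
      omega
    · have := h1 j
      rcases eq_or_ne j i with rfl | hj
      · rw [Pi.single_eq_same]
        omega
      · rw [Pi.single_eq_of_ne hj]
        omega
  · rw [tsum_eq_sum (s := B) fun z hz => by simp [hB z hz], Finset.sum_comm]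
    have hi (i : Fin d) : ∑ z ∈ B, φ z i ^ 2 ≤ 2 * 6 ^ d * (2 ^ d * 3) * gdim d (m + 1) := by
      have henergy := sum_sq_sum_le B (fun n z => stepFlow d (n + 1) z i) (6 ^ d)
        (fun n => (2 * ((n + 1 : ℕ) : ℝ)⁻¹) ^ d)
        (fun n z => abs_stepFlow_le d (n + 1) (by omega) z i) (fun n => by positivity) (hM i) m
      refine henergy.trans ?_
      have hscale : ∑ n ∈ Finset.range m, ((n : ℝ) + 1) * (2 * ((n + 1 : ℕ) : ℝ)⁻¹) ^ d
          = 2 ^ d * ∑ n ∈ Finset.range m, ((n : ℝ) + 1) * (((n : ℝ) + 1)⁻¹) ^ d := by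
        rw [Finset.mul_sum]
        refine Finset.sum_congr rfl fun n _ => ?_
        push_cast
        rw [mul_pow]
        ring
      rw [hscale, mul_assoc (2 * 6 ^ d), mul_assoc (2 ^ d)]
      gcongr
      exact sum_scales_le_gdim d m hd
    calc _ ≤ ∑ _i : Fin d, 2 * 6 ^ d * (2 ^ d * 3) * gdim d (m + 1) :=
          Finset.sum_le_sum fun i _ => hi i
      _ = _ := by
          simp only [Finset.sum_const, Finset.card_univ, Fintype.card_fin, nsmul_eq_mul]
          ring
  · rw [tsum_eq_sum (s := B) fun z hz => by simp [hB z hz], Finset.sum_comm]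
    have hone : (1 : ℝ) ≤ 2 ^ d := one_le_pow₀ (by norm_num)
    calc _ ≤ ∑ _i : Fin d, (m : ℝ) * 6 ^ d :=
          Finset.sum_le_sum fun i _ =>
            sum_abs_sum_le B (fun n z => stepFlow d (n + 1) z i) (6 ^ d) (hM i) m
      _ = d * 6 ^ d * m := by
          simp only [Finset.sum_const, Finset.card_univ, Fintype.card_fin, nsmul_eq_mul]
          ring
      _ ≤ d * 6 ^ d * (2 * (2 ^ d * 3)) * ((m + 1 : ℕ) : ℝ) := by
          push_cast
          gcongr ?_ * ?_
          · exact le_mul_of_one_le_right (by positivity) (by linarith)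
          · linarith
      _ = _ := by ring

end
end

section
/- Let X₁ and X₂ be real random variables on the same probability space (not assumed independent) such that X₁ is sub-Gaussian of order σ₁² and X₂ is sub-Gaussian of order σ₂², with σ₁, σ₂ > 0. Then for every γ with 0 < γ ≤ 1/(4 σ₁ σ₂), E[e^{γ X₁ X₂}] ≤ 3. -/
open MeasureTheory

/-- Completing the square in a Gaussian integral, as a lower Lebesgue integral. -/
lemma lintegral_exp_mul_sub_sq (u : ℝ) :
    ∫⁻ θ : ℝ, ENNReal.ofReal (Real.exp (θ * u - θ ^ 2)) =
      ENNReal.ofReal (Real.sqrt Real.pi * Real.exp (u ^ 2 / 4)) := by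
  have hsq (θ : ℝ) : Real.exp (θ * u - θ ^ 2) =
      Real.exp (u ^ 2 / 4) * Real.exp (-1 * (θ - u / 2) ^ 2) := by
    rw [← Real.exp_add]
    ring_nf
  have hint : Integrable (fun θ : ℝ => Real.exp (-1 * (θ - u / 2) ^ 2)) :=
    (integrable_exp_neg_mul_sq one_pos).comp_sub_right (u / 2)
  simp_rw [hsq]
  rw [← ofReal_integral_eq_lintegral_ofReal (hint.const_mul _)
    (Filter.Eventually.of_forall fun _ => by positivity), integral_const_mul,
    integral_sub_right_eq_self (fun θ : ℝ => Real.exp (-1 * θ ^ 2)), integral_gaussian,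
    div_one, mul_comm]

/-- The exponential square moment of a sub-Gaussian random variable of order `σ ^ 2`. -/
lemma lintegral_exp_sq_le_sqrt_two {Ω : Type*} [MeasurableSpace Ω] (μ : Measure Ω)
    [IsProbabilityMeasure μ] {X : Ω → ℝ} (hX : Measurable X) {σ : ℝ} (hσ : 0 < σ)
    (hsub : ∀ θ : ℝ, Integrable (fun ω => Real.exp (θ * X ω)) μ ∧
      Real.log (∫ ω, Real.exp (θ * X ω) ∂μ) ≤ σ ^ 2 * θ ^ 2 / 2) :
    ∫⁻ ω, ENNReal.ofReal (Real.exp ((X ω / σ) ^ 2 / 4)) ∂μ ≤ ENNReal.ofReal (Real.sqrt 2) := by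
  have hmgf (θ : ℝ) : ∫⁻ ω, ENNReal.ofReal (Real.exp (θ * (X ω / σ) - θ ^ 2)) ∂μ ≤
      ENNReal.ofReal (Real.exp (-(1 / 2) * θ ^ 2)) := by
    obtain ⟨hint, hlog⟩ := hsub (θ / σ)
    have heq (ω : Ω) : Real.exp (θ * (X ω / σ) - θ ^ 2) =
        Real.exp (-θ ^ 2) * Real.exp (θ / σ * X ω) := by
      rw [← Real.exp_add]
      ring_nf
    simp_rw [heq]
    rw [← ofReal_integral_eq_lintegral_ofReal (hint.const_mul _)
      (Filter.Eventually.of_forall fun _ => by positivity), integral_const_mul]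
    apply ENNReal.ofReal_le_ofReal
    have hle := (Real.log_le_iff_le_exp (integral_exp_pos hint)).1 hlog
    calc _ ≤ Real.exp (-θ ^ 2) * Real.exp (σ ^ 2 * (θ / σ) ^ 2 / 2) := by gcongr
      _ = _ := by
        rw [← Real.exp_add]
        congr 1
        field_simp
        ring
  have hpi : 0 < Real.sqrt Real.pi := Real.sqrt_pos.2 Real.pi_pos
  have hscaled : ENNReal.ofReal (Real.sqrt Real.pi) *
      ∫⁻ ω, ENNReal.ofReal (Real.exp ((X ω / σ) ^ 2 / 4)) ∂μ ≤
      ENNReal.ofReal (Real.sqrt Real.pi) * ENNReal.ofReal (Real.sqrt 2) := by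
    calc _ = ∫⁻ ω, (∫⁻ θ : ℝ, ENNReal.ofReal (Real.exp (θ * (X ω / σ) - θ ^ 2))) ∂μ := by
          rw [← lintegral_const_mul _ (by fun_prop)]
          simp_rw [lintegral_exp_mul_sub_sq, ENNReal.ofReal_mul hpi.le]
      _ = ∫⁻ θ : ℝ, ∫⁻ ω, ENNReal.ofReal (Real.exp (θ * (X ω / σ) - θ ^ 2)) ∂μ :=
          lintegral_lintegral_swap (by unfold Function.uncurry; fun_prop)
      _ ≤ ∫⁻ θ : ℝ, ENNReal.ofReal (Real.exp (-(1 / 2) * θ ^ 2)) := lintegral_mono hmgf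
      _ = _ := by
          rw [← ofReal_integral_eq_lintegral_ofReal (integrable_exp_neg_mul_sq (by norm_num))
            (Filter.Eventually.of_forall fun _ => by positivity), integral_gaussian,
            ← ENNReal.ofReal_mul hpi.le, ← Real.sqrt_mul Real.pi_pos.le]
          congr 2
          ring
  exact (ENNReal.mul_le_mul_iff_right (by simpa using hpi) ENNReal.ofReal_ne_top).1 hscaled

lemma exp_mul_le_exp_sq_add_exp_sq {x y a b γ : ℝ} (ha : 0 < a) (hb : 0 < b) (hγ0 : 0 < γ)
    (hγ : γ ≤ 1 / (4 * a * b)) :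
    Real.exp (γ * (x * y)) ≤ Real.exp ((x / a) ^ 2 / 4) + Real.exp ((y / b) ^ 2 / 4) := by
  set u := x / a with hu
  set v := y / b with hv
  have hxy : γ * (x * y) ≤ 1 / 4 * |u * v| := by
    calc γ * (x * y) ≤ γ * |x * y| := by gcongr; exact le_abs_self _
      _ ≤ 1 / (4 * a * b) * |x * y| := by gcongr
      _ = 1 / 4 * |u * v| := by
        rw [hu, hv, abs_mul, abs_mul, abs_div, abs_div, abs_of_pos ha, abs_of_pos hb]
        field_simp
  have hmax : γ * (x * y) ≤ max (u ^ 2 / 4) (v ^ 2 / 4) := by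
    rw [abs_mul] at hxy
    have h₁ := le_max_left (u ^ 2 / 4) (v ^ 2 / 4)
    have h₂ := le_max_right (u ^ 2 / 4) (v ^ 2 / 4)
    nlinarith [sq_nonneg (|u| - |v|), sq_abs u, sq_abs v]
  rcases le_max_iff.1 hmax with h | h
  · linarith [Real.exp_le_exp.2 h, Real.exp_pos (v ^ 2 / 4)]
  · linarith [Real.exp_le_exp.2 h, Real.exp_pos (u ^ 2 / 4)]

/-- If `X₁` is sub-Gaussian of order `σ₁²` and `X₂` is sub-Gaussian of order `σ₂²`
(not necessarily independent), then `E[exp (γ X₁ X₂)] ≤ 3` for every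
`0 < γ ≤ 1/(4 σ₁ σ₂)`. -/
theorem statement12 {Ω : Type*} [MeasurableSpace Ω] (μ : Measure Ω) [IsProbabilityMeasure μ]
    (X₁ X₂ : Ω → ℝ) (hX₁ : Measurable X₁) (hX₂ : Measurable X₂)
    (σ₁ σ₂ : ℝ) (hσ₁ : 0 < σ₁) (hσ₂ : 0 < σ₂)
    (hsub₁ : ∀ θ : ℝ, Integrable (fun ω => Real.exp (θ * X₁ ω)) μ ∧
      Real.log (∫ ω, Real.exp (θ * X₁ ω) ∂μ) ≤ σ₁ ^ 2 * θ ^ 2 / 2)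
    (hsub₂ : ∀ θ : ℝ, Integrable (fun ω => Real.exp (θ * X₂ ω)) μ ∧
      Real.log (∫ ω, Real.exp (θ * X₂ ω) ∂μ) ≤ σ₂ ^ 2 * θ ^ 2 / 2)
    (γ : ℝ) (hγ0 : 0 < γ) (hγ : γ ≤ 1 / (4 * σ₁ * σ₂)) :
    Integrable (fun ω => Real.exp (γ * (X₁ ω * X₂ ω))) μ ∧
      ∫ ω, Real.exp (γ * (X₁ ω * X₂ ω)) ∂μ ≤ 3 := by
  have hle : ∫⁻ ω, ENNReal.ofReal (Real.exp (γ * (X₁ ω * X₂ ω))) ∂μ ≤ ENNReal.ofReal 3 := by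
    calc _ ≤ ∫⁻ ω, (ENNReal.ofReal (Real.exp ((X₁ ω / σ₁) ^ 2 / 4)) +
            ENNReal.ofReal (Real.exp ((X₂ ω / σ₂) ^ 2 / 4))) ∂μ := by
          refine lintegral_mono fun ω => ?_
          rw [← ENNReal.ofReal_add (by positivity) (by positivity)]
          exact ENNReal.ofReal_le_ofReal (exp_mul_le_exp_sq_add_exp_sq hσ₁ hσ₂ hγ0 hγ)
      _ ≤ ENNReal.ofReal (Real.sqrt 2) + ENNReal.ofReal (Real.sqrt 2) := by
          rw [lintegral_add_left (by fun_prop)]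
          exact add_le_add (lintegral_exp_sq_le_sqrt_two μ hX₁ hσ₁ hsub₁)
            (lintegral_exp_sq_le_sqrt_two μ hX₂ hσ₂ hsub₂)
      _ ≤ ENNReal.ofReal 3 := by
          rw [← ENNReal.ofReal_add (by positivity) (by positivity)]
          apply ENNReal.ofReal_le_ofReal
          have : Real.sqrt 2 ≤ 3 / 2 := Real.sqrt_le_iff.2 (by norm_num)
          linarith
  have hmeas : AEStronglyMeasurable (fun ω => Real.exp (γ * (X₁ ω * X₂ ω))) μ := by fun_prop
  have hnn : 0 ≤ᵐ[μ] fun ω => Real.exp (γ * (X₁ ω * X₂ ω)) :=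
    Filter.Eventually.of_forall fun _ => by positivity
  refine ⟨⟨hmeas, (hasFiniteIntegral_iff_ofReal hnn).2 (hle.trans_lt ENNReal.ofReal_lt_top)⟩, ?_⟩
  rw [integral_eq_lintegral_of_nonneg_ae hnn hmeas]
  exact ENNReal.toReal_le_of_le_ofReal (by norm_num) hle
end

section
/- Let V : ℝ → ℝ be continuous with c₋ r² ≤ 2 V(r) ≤ c₊ r² for all r ∈ ℝ, where c₊ ≥ c₋ > 0. For τ ∈ ℝ let π_τ be the probability measure on ℝ with density Z(τ)^{−1} e^{−V(r) + τ r}, where Z(τ) = ∫_ℝ e^{−V(r) + τ r} dr (which is finite). If F : ℝ → ℝ is measurable with |F(r)| ≤ c |r| for all r and some constant c > 0, then F − E_{π_τ}[F] is sub-Gaussian under π_τ of some order C = C(τ, c, c₋, c₊): there exists a finite constant C, depending only on τ, c, c₋, c₊, such that log E_{π_τ}[exp(θ (F − E_{π_τ}[F]))] ≤ (1/2) C θ² for all θ ∈ ℝ. -/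
open MeasureTheory

/-- The elementary inequality `eˣ ≤ x + e^{x²}`. -/
theorem exp_le_add_exp_sq (x : ℝ) : Real.exp x ≤ x + Real.exp (x ^ 2) := by
  have hsq := Real.add_one_le_exp (x ^ 2)
  rcases le_total |x| 1 with h | h
  · have := (abs_le.1 (Real.abs_exp_sub_one_sub_id_le h)).2
    linarith
  · rcases le_abs.1 h with h | h
    · have : Real.exp x ≤ Real.exp (x ^ 2) := Real.exp_le_exp.2 (by nlinarith)
      linarith
    · have : Real.exp x ≤ 1 := Real.exp_le_one_iff.2 (by linarith)
      nlinarith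

/-- Chord bound for the exponential on the segment from `0` to `x`. -/
theorem exp_mul_le_one_add_mul {t : ℝ} (ht0 : 0 ≤ t) (ht1 : t ≤ 1) (x : ℝ) :
    Real.exp (t * x) ≤ 1 + t * (Real.exp x - 1) := by
  have := convexOn_exp.2 (Set.mem_univ (0 : ℝ)) (Set.mem_univ x) (sub_nonneg.2 ht1) ht0
    (sub_add_cancel 1 t)
  simp only [smul_eq_mul, mul_zero, zero_add, Real.exp_zero, mul_one] at this
  linarith

theorem abs_le_exp_add_exp_neg (x : ℝ) : |x| ≤ Real.exp x + Real.exp (-x) := by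
  have h₁ := Real.add_one_le_exp x
  have h₂ := Real.add_one_le_exp (-x)
  have h₃ := Real.exp_pos x
  have h₄ := Real.exp_pos (-x)
  exact abs_le.2 ⟨by linarith, by linarith⟩

/-- A centered random variable with a finite square-exponential moment is sub-Gaussian. -/
theorem integral_exp_mul_le_of_integral_exp_sq_le {Ω : Type*} [MeasurableSpace Ω]
    {μ : Measure Ω} [IsProbabilityMeasure μ] {X : Ω → ℝ} {s M : ℝ} (hs : 0 < s)
    (hX : Integrable X μ) (hX0 : ∫ ω, X ω ∂μ = 0)
    (hexp : Integrable (fun ω ↦ Real.exp (s * X ω ^ 2)) μ)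
    (hM : ∫ ω, Real.exp (s * X ω ^ 2) ∂μ ≤ M) (θ : ℝ) :
    ∫ ω, Real.exp (θ * X ω) ∂μ ≤ Real.exp ((1 / 4 + M) / s * θ ^ 2) := by
  have hM0 : 0 ≤ M := (integral_nonneg fun ω ↦ (Real.exp_pos _).le).trans hM
  have hθ : 0 ≤ θ ^ 2 / s := by positivity
  have hC : (1 / 4 + M) / s * θ ^ 2 = θ ^ 2 / s / 4 + θ ^ 2 / s * M := by ring
  rw [hC]
  rcases le_total (θ ^ 2 / s) 1 with h | h
  · have hdom : Integrable (fun ω ↦ θ ^ 2 / s * (Real.exp (s * X ω ^ 2) - 1)) μ :=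
      (hexp.sub (integrable_const 1)).const_mul _
    have hone : Integrable (fun ω ↦ 1 + θ ^ 2 / s * (Real.exp (s * X ω ^ 2) - 1)) μ :=
      (integrable_const 1).add hdom
    calc ∫ ω, Real.exp (θ * X ω) ∂μ
        ≤ ∫ ω, (θ * X ω + (1 + θ ^ 2 / s * (Real.exp (s * X ω ^ 2) - 1))) ∂μ := by
          refine integral_mono_of_nonneg (.of_forall fun ω ↦ (Real.exp_pos _).le)
            ((hX.const_mul θ).add hone) (.of_forall fun ω ↦ ?_)
          have h₁ := exp_le_add_exp_sq (θ * X ω)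
          have h₂ := exp_mul_le_one_add_mul hθ h (s * X ω ^ 2)
          have h₃ : θ ^ 2 / s * (s * X ω ^ 2) = (θ * X ω) ^ 2 := by field_simp
          rw [h₃] at h₂
          exact h₁.trans (by linarith)
      _ = 1 + θ ^ 2 / s * (∫ ω, Real.exp (s * X ω ^ 2) ∂μ - 1) := by
          rw [integral_add (hX.const_mul θ) hone,
            integral_add (integrable_const 1) hdom, integral_const_mul, integral_const_mul,
            integral_sub hexp (integrable_const 1), hX0]
          simp
      _ ≤ θ ^ 2 / s / 4 + θ ^ 2 / s * M + 1 := by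
          nlinarith [mul_le_mul_of_nonneg_left hM hθ]
      _ ≤ _ := Real.add_one_le_exp _
  · calc ∫ ω, Real.exp (θ * X ω) ∂μ
        ≤ ∫ ω, Real.exp (θ ^ 2 / s / 4) * Real.exp (s * X ω ^ 2) ∂μ := by
          refine integral_mono_of_nonneg (.of_forall fun ω ↦ (Real.exp_pos _).le)
            (hexp.const_mul _) (.of_forall fun ω ↦ ?_)
          simp only [← Real.exp_add]
          refine Real.exp_le_exp.2 ?_
          have : θ ^ 2 / s / 4 + s * X ω ^ 2 - θ * X ω = (θ - 2 * s * X ω) ^ 2 / (4 * s) := by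
            field_simp
            ring
          have : 0 ≤ (θ - 2 * s * X ω) ^ 2 / (4 * s) := by positivity
          linarith
      _ = Real.exp (θ ^ 2 / s / 4) * ∫ ω, Real.exp (s * X ω ^ 2) ∂μ := integral_const_mul _ _
      _ ≤ Real.exp (θ ^ 2 / s / 4) * Real.exp (θ ^ 2 / s * M) := by
          gcongr
          nlinarith [Real.add_one_le_exp (θ ^ 2 / s * M)]
      _ = _ := (Real.exp_add _ _).symm

theorem integrable_exp_neg_mul_sq_add_mul {b : ℝ} (hb : 0 < b) (t : ℝ) :
    Integrable fun x : ℝ ↦ Real.exp (-b * x ^ 2 + t * x) := by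
  have h := (integrable_cexp_quadratic (b := b) (by simpa using hb) (t : ℂ) 0).norm
  refine h.congr (.of_forall fun x ↦ ?_)
  simp only [Complex.norm_exp]
  norm_cast
  simp

/-- The mean under a Gibbs measure of a function of linear growth is bounded in terms of the
Gaussian envelopes of the density. -/
theorem abs_mean_tilted_le {W F : ℝ → ℝ} {τ c a b : ℝ} (hb : 0 < b)
    (hc : 0 ≤ c) (ha : 0 < a) (hW : Integrable fun r ↦ Real.exp (W r))
    (hub : ∀ r, W r ≤ -a * r ^ 2 + τ * r) (hlb : ∀ r, -b * r ^ 2 + τ * r ≤ W r)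
    (hF : Measurable F) (hFc : ∀ r, |F r| ≤ c * |r|) :
    Integrable F (volume.tilted W) ∧ |∫ r, F r ∂volume.tilted W| ≤
      (∫ r : ℝ, c * (Real.exp (-a * r ^ 2 + (τ + 1) * r) + Real.exp (-a * r ^ 2 + (τ - 1) * r))) /
        ∫ r : ℝ, Real.exp (-b * r ^ 2 + τ * r) := by
  have hdom : Integrable fun r : ℝ ↦
      c * (Real.exp (-a * r ^ 2 + (τ + 1) * r) + Real.exp (-a * r ^ 2 + (τ - 1) * r)) :=
    ((integrable_exp_neg_mul_sq_add_mul ha _).add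
      (integrable_exp_neg_mul_sq_add_mul ha _)).const_mul c
  have hle (r : ℝ) : ‖Real.exp (W r) * F r‖ ≤
      c * (Real.exp (-a * r ^ 2 + (τ + 1) * r) + Real.exp (-a * r ^ 2 + (τ - 1) * r)) := by
    have hsplit : Real.exp (-a * r ^ 2 + (τ + 1) * r) + Real.exp (-a * r ^ 2 + (τ - 1) * r) =
        Real.exp (-a * r ^ 2 + τ * r) * (Real.exp r + Real.exp (-r)) := by
      rw [mul_add, ← Real.exp_add, ← Real.exp_add]
      ring_nf
    rw [hsplit, norm_mul, Real.norm_eq_abs, Real.norm_eq_abs, Real.abs_exp]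
    calc Real.exp (W r) * |F r|
        ≤ Real.exp (-a * r ^ 2 + τ * r) * (c * (Real.exp r + Real.exp (-r))) := by
          gcongr
          · exact hub r
          · exact (hFc r).trans (mul_le_mul_of_nonneg_left (abs_le_exp_add_exp_neg r) hc)
      _ = _ := by ring
  have hlow := integrable_exp_neg_mul_sq_add_mul hb τ
  have hZ : ∫ r : ℝ, Real.exp (-b * r ^ 2 + τ * r) ≤ ∫ r, Real.exp (W r) :=
    integral_mono hlow hW fun r ↦ Real.exp_le_exp.2 (hlb r)
  refine ⟨(integrable_tilted_iff hW F).2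
    (hdom.mono' (hW.1.smul hF.aestronglyMeasurable) (.of_forall hle)), ?_⟩
  rw [integral_tilted]
  simp only [smul_eq_mul, div_mul_eq_mul_div]
  rw [integral_div, abs_div, abs_of_pos (integral_exp_pos hW)]
  exact div_le_div₀ (integral_nonneg fun r ↦ by positivity)
    (norm_integral_le_of_norm_le hdom (.of_forall hle)) (integral_exp_pos hlow) hZ

/-- Square-exponential moments, about any bounded center, of a function of linear growth under a
Gibbs measure are bounded in terms of the Gaussian envelopes of the density. -/
theorem integral_exp_sq_tilted_le {W F : ℝ → ℝ} {τ c a b s m m₀ : ℝ} (hb : 0 < b) (hs : 0 ≤ s)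
    (hsa : 2 * s * c ^ 2 < a) (hW : Integrable fun r ↦ Real.exp (W r))
    (hub : ∀ r, W r ≤ -a * r ^ 2 + τ * r) (hlb : ∀ r, -b * r ^ 2 + τ * r ≤ W r)
    (hF : Measurable F) (hFc : ∀ r, |F r| ≤ c * |r|) (hm : |m| ≤ m₀) :
    Integrable (fun r ↦ Real.exp (s * (F r - m) ^ 2)) (volume.tilted W) ∧
      ∫ r, Real.exp (s * (F r - m) ^ 2) ∂volume.tilted W ≤
        (∫ r : ℝ, Real.exp (2 * s * m₀ ^ 2) * Real.exp (-(a - 2 * s * c ^ 2) * r ^ 2 + τ * r)) /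
          ∫ r : ℝ, Real.exp (-b * r ^ 2 + τ * r) := by
  have hdom : Integrable fun r : ℝ ↦
      Real.exp (2 * s * m₀ ^ 2) * Real.exp (-(a - 2 * s * c ^ 2) * r ^ 2 + τ * r) :=
    (integrable_exp_neg_mul_sq_add_mul (sub_pos.2 hsa) _).const_mul _
  have hle (r : ℝ) : ‖Real.exp (W r) * Real.exp (s * (F r - m) ^ 2)‖ ≤
      Real.exp (2 * s * m₀ ^ 2) * Real.exp (-(a - 2 * s * c ^ 2) * r ^ 2 + τ * r) := by
    rw [← Real.exp_add, ← Real.exp_add, Real.norm_eq_abs, Real.abs_exp]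
    refine Real.exp_le_exp.2 ?_
    have hF2 : F r ^ 2 ≤ c ^ 2 * r ^ 2 := by
      have := pow_le_pow_left₀ (abs_nonneg _) (hFc r) 2
      rwa [mul_pow, sq_abs, sq_abs] at this
    have hm2 : m ^ 2 ≤ m₀ ^ 2 := by
      simpa only [sq_abs] using pow_le_pow_left₀ (abs_nonneg _) hm 2
    have : s * (F r - m) ^ 2 ≤ s * (2 * (c ^ 2 * r ^ 2) + 2 * m₀ ^ 2) :=
      mul_le_mul_of_nonneg_left (by nlinarith [sq_nonneg (F r + m)]) hs
    linarith [hub r]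
  have hlow := integrable_exp_neg_mul_sq_add_mul hb τ
  have hZ : ∫ r : ℝ, Real.exp (-b * r ^ 2 + τ * r) ≤ ∫ r, Real.exp (W r) :=
    integral_mono hlow hW fun r ↦ Real.exp_le_exp.2 (hlb r)
  have hmeas : Measurable fun r ↦ Real.exp (s * (F r - m) ^ 2) := by fun_prop
  refine ⟨(integrable_tilted_iff hW _).2
    (hdom.mono' (hW.1.smul hmeas.aestronglyMeasurable) (.of_forall hle)), ?_⟩
  rw [integral_tilted]
  simp only [smul_eq_mul, div_mul_eq_mul_div]
  rw [integral_div]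
  exact div_le_div₀ (integral_nonneg fun r ↦ by positivity)
    ((le_abs_self _).trans (norm_integral_le_of_norm_le hdom (.of_forall hle)))
    (integral_exp_pos hlow) hZ

/-- For a potential `V` with `c₋ r² ≤ 2V(r) ≤ c₊ r²` and any `F` with `|F(r)| ≤ c|r|`,
the centered variable `F − E_{π_τ}[F]` is sub-Gaussian under the Gibbs measure
`π_τ(dr) = Z(τ)⁻¹ e^{−V(r)+τr} dr`, with order depending only on `τ, c, c₋, c₊`. -/
theorem statement13 (τ c cm cp : ℝ) (hc : 0 < c) (hcm : 0 < cm) (hcmcp : cm ≤ cp) :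
    ∃ C : ℝ, ∀ V F : ℝ → ℝ, Continuous V →
      (∀ r : ℝ, cm * r ^ 2 ≤ 2 * V r) → (∀ r : ℝ, 2 * V r ≤ cp * r ^ 2) →
      Measurable F → (∀ r : ℝ, |F r| ≤ c * |r|) →
      ∀ θ : ℝ,
        Real.log ((∫ r : ℝ,
            Real.exp (θ * (F r
              - (∫ r' : ℝ, F r' * Real.exp (-V r' + τ * r'))
                  / (∫ r' : ℝ, Real.exp (-V r' + τ * r'))))
            * Real.exp (-V r + τ * r))
          / (∫ r' : ℝ, Real.exp (-V r' + τ * r')))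
        ≤ C * θ ^ 2 / 2 := by
  set Z₀ := ∫ r : ℝ, Real.exp (-(cp / 2) * r ^ 2 + τ * r)
  set m₀ := (∫ r : ℝ, c * (Real.exp (-(cm / 2) * r ^ 2 + (τ + 1) * r) +
    Real.exp (-(cm / 2) * r ^ 2 + (τ - 1) * r))) / Z₀
  set s := cm / (8 * c ^ 2) with hs_def
  set M := (∫ r : ℝ, Real.exp (2 * s * m₀ ^ 2) *
    Real.exp (-(cm / 2 - 2 * s * c ^ 2) * r ^ 2 + τ * r)) / Z₀
  refine ⟨2 * ((1 / 4 + M) / s), fun V F hV hVl hVu hF hFc θ ↦ ?_⟩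
  have hs : 0 < s := by positivity
  have hsa : 2 * s * c ^ 2 < cm / 2 := by
    have : 2 * s * c ^ 2 = cm / 4 := by
      rw [hs_def]
      field_simp
      norm_num
    linarith
  have hcp : 0 < cp / 2 := by linarith
  let W : ℝ → ℝ := fun r ↦ -V r + τ * r
  have hub (r : ℝ) : W r ≤ -(cm / 2) * r ^ 2 + τ * r := by
    linarith [hVl r, show W r = -V r + τ * r from rfl]
  have hlb (r : ℝ) : -(cp / 2) * r ^ 2 + τ * r ≤ W r := by
    linarith [hVu r, show W r = -V r + τ * r from rfl]
  have hWc : Continuous fun r ↦ Real.exp (W r) := by fun_prop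
  have hW : Integrable fun r ↦ Real.exp (W r) :=
    (integrable_exp_neg_mul_sq_add_mul (half_pos hcm) τ).mono' hWc.aestronglyMeasurable
      (.of_forall fun r ↦ by
        rw [Real.norm_eq_abs, Real.abs_exp]
        exact Real.exp_le_exp.2 (hub r))
  have := isProbabilityMeasure_tilted hW
  have hexpect (G : ℝ → ℝ) : (∫ r, G r * Real.exp (-V r + τ * r)) /
      (∫ r, Real.exp (-V r + τ * r)) = ∫ r, G r ∂volume.tilted W := by
    rw [integral_tilted, ← integral_div]
    congr 1 with r
    simp only [W, smul_eq_mul]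
    ring
  rw [hexpect, hexpect]
  set m := ∫ r, F r ∂volume.tilted W with hm_def
  obtain ⟨hFint, hm⟩ := abs_mean_tilted_le hcp hc.le (half_pos hcm) hW hub hlb hF hFc
  obtain ⟨hexp, hM⟩ := integral_exp_sq_tilted_le hcp hs.le hsa hW hub hlb hF hFc hm
  have hmean : ∫ r, (F r - m) ∂volume.tilted W = 0 := by
    rw [integral_sub hFint (integrable_const m)]
    simp [hm_def]
  have hmgf := integral_exp_mul_le_of_integral_exp_sq_le hs
    (hFint.sub (integrable_const m)) hmean hexp hM θ
  have hM0 : 0 ≤ M := (integral_nonneg fun r ↦ (Real.exp_pos _).le).trans hM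
  have hC : 2 * ((1 / 4 + M) / s) * θ ^ 2 / 2 = (1 / 4 + M) / s * θ ^ 2 := by ring
  rw [hC]
  rcases (integral_nonneg fun r ↦ (Real.exp_pos (θ * (F r - m))).le :
    0 ≤ ∫ r, Real.exp (θ * (F r - m)) ∂volume.tilted W).eq_or_lt with h | h
  · rw [← h, Real.log_zero]
    positivity
  · exact (Real.log_le_iff_le_exp h).2 hmgf
end

section
/- Explicit solution of the non-resonance correction equations for a 2×2 system in dimension one (m = 1): with c₁ = −(λ₁ − λ₂)^{−1} l₁ᵀH(r₁, r₂) and c₂ = (λ₁ − λ₂)^{−1} l₂ᵀH(r₁, r₂), the functions σ̃_{1,1,2}(s,u,u′) = c₁ σ₁(s,u) σ₂(s,u′), σ̃_{1,2,1}(s,u,u′) = c₁ Σ₂(s,u) ∂_u σ₁(s,u′), σ̃_{2,1,2}(s,u,u′) = c₂ Σ₁(s,u) ∂_u σ₂(s,u′), σ̃_{2,2,1}(s,u,u′) = c₂ σ₂(s,u) σ₁(s,u′) satisfy, for every (k, j, j′) ∈ {(1,1,2), (1,2,1), (2,1,2), (2,2,1)} and all (s, u, u′), the transport equation ((λ_j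 − λ_k) ∂_u + (λ_{j′} − λ_k) ∂_{u′}) σ̃_{k,j,j′}(s,u,u′) = l_kᵀ H(r_j, r_{j′}) σ_j(s,u) ∂_{u′} σ_{j′}(s,u′). -/
/-- For a `C²` function, iterated directional derivatives in two directions commute. -/
theorem fderiv_fderiv_apply_comm_of_contDiff {E F : Type*} [NormedAddCommGroup E]
    [NormedSpace ℝ E] [NormedAddCommGroup F] [NormedSpace ℝ F] {f : E → F}
    (hf : ContDiff ℝ 2 f) (x v v' : E) :
    fderiv ℝ (fun w => fderiv ℝ f w v) x v' = fderiv ℝ (fun w => fderiv ℝ f w v') x v := by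
  have hd : DifferentiableAt ℝ (fderiv ℝ f) x :=
    (hf.fderiv_right (m := 1) (by norm_num)).differentiable (by norm_num) x
  have hsymm : IsSymmSndFDerivAt ℝ f x :=
    hf.contDiffAt.isSymmSndFDerivAt (by simp)
  have happly (a b : E) :
      fderiv ℝ (fun w => fderiv ℝ f w a) x b = fderiv ℝ (fderiv ℝ f) x b a := by
    rw [fderiv_clm_apply hd (differentiableAt_const a)]
    simp
  rw [happly, happly, hsymm.eq]

/-- Explicit solution of the non-resonance correction equations for a strictly
hyperbolic 2×2 system of conservation laws in dimension one (`m = 1`): with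
`c₁ = −(λ₁−λ₂)⁻¹ l₁ᵀH(r₁,r₂)` and `c₂ = (λ₁−λ₂)⁻¹ l₂ᵀH(r₁,r₂)`, the functions
`σ̃_{1,1,2} = c₁ σ₁(u) σ₂(u′)`, `σ̃_{1,2,1} = c₁ Σ₂(u) ∂_u σ₁(u′)`,
`σ̃_{2,1,2} = c₂ Σ₁(u) ∂_u σ₂(u′)`, `σ̃_{2,2,1} = c₂ σ₂(u) σ₁(u′)` satisfy the
transport equations
`((λ_j−λ_k) ∂_u + (λ_{j′}−λ_k) ∂_{u′}) σ̃_{k,j,j′} = l_kᵀH(r_j,r_{j′}) σ_j ∂_{u′}σ_{j′}`.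
Indices `0, 1 : Fin 2` play the role of `1, 2`. -/
theorem statement16 (T : ℝ) (hT : 0 < T)
    (J : (Fin 2 → ℝ) → Fin 2 → ℝ) (wstar : Fin 2 → ℝ) (hJ : ContDiff ℝ 2 J)
    (lam : Fin 2 → ℝ) (hlam : lam 0 ≠ lam 1) (l r : Fin 2 → Fin 2 → ℝ)
    (hleft : ∀ (j : Fin 2) (v : Fin 2 → ℝ),
      ∑ i, l j i * fderiv ℝ J wstar v i = lam j * ∑ i, l j i * v i)
    (hright : ∀ j : Fin 2, fderiv ℝ J wstar (r j) = lam j • r j)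
    (hbiorth : ∀ j k : Fin 2, ∑ i, l j i * r k i = if j = k then (1 : ℝ) else 0)
    (σ Sig : Fin 2 → ℝ → ℝ → ℝ)
    (hσ : ∀ (j : Fin 2) (s : ℝ), Differentiable ℝ (fun u => σ j s u))
    (hSig : ∀ (j : Fin 2) (s u : ℝ), HasDerivAt (fun w => Sig j s w) (σ j s u) u) :
    let H : (Fin 2 → ℝ) → (Fin 2 → ℝ) → Fin 2 → ℝ := fun v v' i =>
      fderiv ℝ (fun w => fderiv ℝ (fun w' => J w' i) w v) wstar v'
    let lH : Fin 2 → Fin 2 → Fin 2 → ℝ := fun k j j' => ∑ i, l k i * H (r j) (r j') i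
    let c₁ : ℝ := -(lam 0 - lam 1)⁻¹ * lH 0 0 1
    let c₂ : ℝ := (lam 0 - lam 1)⁻¹ * lH 1 0 1
    ∀ s u u' : ℝ,
      -- (k,j,j') = (1,1,2):  σ̃_{1,1,2}(s,u,u') = c₁ σ₁(s,u) σ₂(s,u')
      ((lam 0 - lam 0) * deriv (fun w => c₁ * σ 0 s w * σ 1 s u') u
        + (lam 1 - lam 0) * deriv (fun w => c₁ * σ 0 s u * σ 1 s w) u'
        = lH 0 0 1 * σ 0 s u * deriv (fun w => σ 1 s w) u') ∧
      -- (k,j,j') = (1,2,1):  σ̃_{1,2,1}(s,u,u') = c₁ Σ₂(s,u) ∂_u σ₁(s,u')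
      ((lam 1 - lam 0) * deriv (fun w => c₁ * Sig 1 s w * deriv (fun z => σ 0 s z) u') u
        + (lam 0 - lam 0) * deriv (fun w => c₁ * Sig 1 s u * deriv (fun z => σ 0 s z) w) u'
        = lH 0 1 0 * σ 1 s u * deriv (fun w => σ 0 s w) u') ∧
      -- (k,j,j') = (2,1,2):  σ̃_{2,1,2}(s,u,u') = c₂ Σ₁(s,u) ∂_u σ₂(s,u')
      ((lam 0 - lam 1) * deriv (fun w => c₂ * Sig 0 s w * deriv (fun z => σ 1 s z) u') u
        + (lam 1 - lam 1) * deriv (fun w => c₂ * Sig 0 s u * deriv (fun z => σ 1 s z) w) u'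
        = lH 1 0 1 * σ 0 s u * deriv (fun w => σ 1 s w) u') ∧
      -- (k,j,j') = (2,2,1):  σ̃_{2,2,1}(s,u,u') = c₂ σ₂(s,u) σ₁(s,u')
      ((lam 1 - lam 1) * deriv (fun w => c₂ * σ 1 s w * σ 0 s u') u
        + (lam 0 - lam 1) * deriv (fun w => c₂ * σ 1 s u * σ 0 s w) u'
        = lH 1 1 0 * σ 1 s u * deriv (fun w => σ 0 s w) u') := by
  intro H lH c₁ c₂ s u u'
  have hcomm (k j j' : Fin 2) : lH k j j' = lH k j' j :=
    Finset.sum_congr rfl fun i _ => congrArg (l k i * ·)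
      (fderiv_fderiv_apply_comm_of_contDiff (contDiff_pi.1 hJ i) wstar (r j) (r j'))
  have hne : lam 0 - lam 1 ≠ 0 := sub_ne_zero.2 hlam
  have hc₁ : (lam 1 - lam 0) * c₁ = lH 0 0 1 := by
    simp only [c₁]
    field_simp
    ring
  have hc₂ : (lam 0 - lam 1) * c₂ = lH 1 0 1 := by
    simp only [c₂]
    field_simp
  have hdσ (j : Fin 2) (c x : ℝ) :
      deriv (fun w => c * σ j s w) x = c * deriv (fun w => σ j s w) x :=
    deriv_const_mul c (hσ j s x)
  have hdSig (j : Fin 2) (c d x : ℝ) : deriv (fun w => c * Sig j s w * d) x = c * σ j s x * d :=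
    (((hSig j s x).const_mul c).mul_const d).deriv
  simp only [sub_self, zero_mul, zero_add, add_zero, hdσ, hdSig, hcomm 0 1 0, hcomm 1 1 0,
    ← hc₁, ← hc₂]
  refine ⟨?_, ?_, ?_, ?_⟩ <;> ring
end
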